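/- arXiv:1802.03616 — 5 statements merged into one kernel-verified Lean document; each statement's English description precedes it below -/
import Mathlib

section
/- Let Λ = {Λ_ω ∈ B(H,E) : ω ∈ Ω} and Θ = {Θ_ω ∈ B(K,E) : ω ∈ Ω} be continuous g-frames for H and for K, both with respect to E. Then Λ and Θ are strongly disjoint if and only if there exist invertible operators L₁ ∈ B(H) and L₂ ∈ B(K) such that {Λ_ω L₁ : ω ∈ Ω}, {Θ_ω L₂ : ω ∈ Ω} and {Δ_ω : ω ∈ Ω}, where Δ_ω(h ⊕ k) = Λ_ω L₁ h + Θ_ω L₂ k on the Hilbert direct sum H ⊕ K, are Parseval continuous g-frames (for H, for K, and for H ⊕ K, respectively). -/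
open MeasureTheory
open scoped ENNReal NNReal Pointwise

noncomputable section

local notation "⟪" x ", " y "⟫" => @inner ℂ _ _ x y

variable {Ω : Type*} [MeasurableSpace Ω]

section Defs

variable {F G E : Type*}
  [NormedAddCommGroup F] [InnerProductSpace ℂ F]
  [NormedAddCommGroup G] [InnerProductSpace ℂ G]
  [NormedAddCommGroup E] [InnerProductSpace ℂ E]

/-- `Λ` is a continuous g-frame for `F` with respect to `E`, with frame bounds `A`, `B`:
for every `f`, `ω ↦ Λ ω f` is strongly measurable and
`A‖f‖² ≤ ∫ ‖Λ ω f‖² dμ(ω) ≤ B‖f‖²`. -/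
def IsCgFrame (μ : Measure Ω) (Λ : Ω → F →L[ℂ] E) (A B : ℝ) : Prop :=
  (∀ f : F, StronglyMeasurable fun ω => Λ ω f) ∧
    ∀ f : F,
      ENNReal.ofReal (A * ‖f‖ ^ 2) ≤ ∫⁻ ω, (‖Λ ω f‖₊ : ℝ≥0∞) ^ 2 ∂μ ∧
        ∫⁻ ω, (‖Λ ω f‖₊ : ℝ≥0∞) ^ 2 ∂μ ≤ ENNReal.ofReal (B * ‖f‖ ^ 2)

/-- `Λ` is a continuous g-Bessel family with Bessel constant `B`. -/
def IsCgBessel (μ : Measure Ω) (Λ : Ω → F →L[ℂ] E) (B : ℝ) : Prop :=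
  (∀ f : F, StronglyMeasurable fun ω => Λ ω f) ∧
    ∀ f : F, ∫⁻ ω, (‖Λ ω f‖₊ : ℝ≥0∞) ^ 2 ∂μ ≤ ENNReal.ofReal (B * ‖f‖ ^ 2)

/-- `Λ` is a tight continuous g-frame with bound `A`. -/
def IsCgTight (μ : Measure Ω) (Λ : Ω → F →L[ℂ] E) (A : ℝ) : Prop :=
  (∀ f : F, StronglyMeasurable fun ω => Λ ω f) ∧
    ∀ f : F, ∫⁻ ω, (‖Λ ω f‖₊ : ℝ≥0∞) ^ 2 ∂μ = ENNReal.ofReal (A * ‖f‖ ^ 2)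

/-- `Λ` is a Parseval continuous g-frame. -/
def IsCgParseval (μ : Measure Ω) (Λ : Ω → F →L[ℂ] E) : Prop :=
  (∀ f : F, StronglyMeasurable fun ω => Λ ω f) ∧
    ∀ f : F, ∫⁻ ω, (‖Λ ω f‖₊ : ℝ≥0∞) ^ 2 ∂μ = ENNReal.ofReal (‖f‖ ^ 2)

/-- The range of the analysis operator `T*_Λ : F → Ê = L²(Ω,μ;E)`, i.e. the set of elements of
`L²(Ω,μ;E)` represented by `ω ↦ Λ ω f` for some `f : F`. -/
def analysisRange (μ : Measure Ω) (Λ : Ω → F →L[ℂ] E) : Set (Lp E 2 μ) :=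
  {φ | ∃ f : F, (fun ω => Λ ω f) =ᵐ[μ] (φ : Ω → E)}

/-- `Λ` and `Θ` are strongly disjoint: the ranges of their analysis operators are orthogonal,
equivalently `∫ ⟨Λ ω h, Θ ω k⟩ dμ(ω) = 0` for all `h`, `k`. -/
def StronglyDisjoint (μ : Measure Ω) (Λ : Ω → F →L[ℂ] E) (Θ : Ω → G →L[ℂ] E) : Prop :=
  ∀ (h : F) (k : G), ∫ ω, ⟪Λ ω h, Θ ω k⟫ ∂μ = 0

/-- `Λ` and `Θ` are disjoint: `Range T*_Λ ∩ Range T*_Θ = {0}` and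
`Range T*_Λ + Range T*_Θ` is closed in `Ê`. -/
def IsDisjoint (μ : Measure Ω) (Λ : Ω → F →L[ℂ] E) (Θ : Ω → G →L[ℂ] E) : Prop :=
  analysisRange μ Λ ∩ analysisRange μ Θ = {(0 : Lp E 2 μ)} ∧
    IsClosed (analysisRange μ Λ + analysisRange μ Θ)

/-- `Λ` and `Θ` are weakly disjoint: `Range T*_Λ ∩ Range T*_Θ = {0}`. -/
def WeaklyDisjoint (μ : Measure Ω) (Λ : Ω → F →L[ℂ] E) (Θ : Ω → G →L[ℂ] E) : Prop :=
  analysisRange μ Λ ∩ analysisRange μ Θ = {(0 : Lp E 2 μ)}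

/-- `Λ` and `Θ` are a complementary pair: `Range T*_Λ ∩ Range T*_Θ = {0}` and
`Range T*_Λ + Range T*_Θ = Ê`. -/
def ComplementaryPair (μ : Measure Ω) (Λ : Ω → F →L[ℂ] E) (Θ : Ω → G →L[ℂ] E) : Prop :=
  analysisRange μ Λ ∩ analysisRange μ Θ = {(0 : Lp E 2 μ)} ∧
    analysisRange μ Λ + analysisRange μ Θ = (Set.univ : Set (Lp E 2 μ))

/-- `Λ` and `Θ` are a strongly complementary pair: `Ê` is the orthogonal direct sum of
`Range T*_Λ` and `Range T*_Θ`. -/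
def StronglyComplementaryPair (μ : Measure Ω) (Λ : Ω → F →L[ℂ] E) (Θ : Ω → G →L[ℂ] E) : Prop :=
  StronglyDisjoint μ Λ Θ ∧
    analysisRange μ Λ + analysisRange μ Θ = (Set.univ : Set (Lp E 2 μ))

/-- `S` is the (continuous g-)frame operator of `Λ`:
`⟨S f, g⟩ = ∫ ⟨Λ ω f, Λ ω g⟩ dμ(ω)`. -/
def IsFrameOperator (μ : Measure Ω) (Λ : Ω → F →L[ℂ] E) (S : F →L[ℂ] F) : Prop :=
  ∀ f g : F, ⟪S f, g⟫ = ∫ ω, ⟪Λ ω f, Λ ω g⟫ ∂μ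

/-- `Θ` is a dual of `Λ`: `∫ ⟨Θ ω f, Λ ω g⟩ dμ(ω) = ⟨f, g⟩` for all `f`, `g`. -/
def IsDualOf (μ : Measure Ω) (Θ Λ : Ω → F →L[ℂ] E) : Prop :=
  ∀ f g : F, ∫ ω, ⟪Θ ω f, Λ ω g⟫ ∂μ = ⟪f, g⟫

/-- `Λ` is a Riesz-type continuous g-frame: it is a continuous g-frame and every dual of `Λ`
is weakly equal to the canonical dual `{Λ_ω S_Λ⁻¹}`, where `S_Λ` is the frame operator. -/
def IsRieszType (μ : Measure Ω) (Λ : Ω → F →L[ℂ] E) : Prop :=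
  (∃ A B : ℝ, 0 < A ∧ IsCgFrame μ Λ A B) ∧
    ∀ S : F ≃L[ℂ] F, IsFrameOperator μ Λ (S : F →L[ℂ] F) →
      ∀ Θ : Ω → F →L[ℂ] E, (∃ A B : ℝ, 0 < A ∧ IsCgFrame μ Θ A B) → IsDualOf μ Θ Λ →
        ∀ f : F, ∀ᵐ ω ∂μ, Θ ω f = Λ ω (S.symm f)

/-- The operator `h ⊕ k ↦ Λω h + Θω k` on the Hilbert direct sum `F ⊕ G = WithLp 2 (F × G)`. -/
def pairMap (Λω : F →L[ℂ] E) (Θω : G →L[ℂ] E) : WithLp 2 (F × G) →L[ℂ] E :=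
  (Λω.comp (ContinuousLinearMap.fst ℂ F G) + Θω.comp (ContinuousLinearMap.snd ℂ F G)).comp
    (WithLp.prodContinuousLinearEquiv 2 ℂ F G).toContinuousLinearMap

end Defs

section Analysis

variable {F G E : Type*}
  [NormedAddCommGroup F] [InnerProductSpace ℂ F]
  [NormedAddCommGroup G] [InnerProductSpace ℂ G]
  [NormedAddCommGroup E] [InnerProductSpace ℂ E]

theorem eLpNorm_two_sq_eq_lintegral {V : Type*} [NormedAddCommGroup V] (μ : Measure Ω)
    (f : Ω → V) :
    eLpNorm f 2 μ ^ 2 = ∫⁻ ω, (‖f ω‖₊ : ℝ≥0∞) ^ 2 ∂μ := by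
  have h := eLpNorm_nnreal_pow_eq_lintegral (f := f) (μ := μ) (p := 2) two_ne_zero
  simpa [enorm_eq_nnnorm] using h

theorem ofReal_norm_sq_eq_lintegral {V : Type*} [NormedAddCommGroup V] {μ : Measure Ω}
    {f : Ω → V} (φ : Lp V 2 μ)
    (h : φ =ᵐ[μ] f) :
    ENNReal.ofReal (‖φ‖ ^ 2) = ∫⁻ ω, (‖f ω‖₊ : ℝ≥0∞) ^ 2 ∂μ := by
  rw [← eLpNorm_two_sq_eq_lintegral, ENNReal.ofReal_pow (norm_nonneg _), ofReal_norm,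
    Lp.enorm_def, eLpNorm_congr_ae h]

/-- The analysis operator of a continuous g-Bessel family. -/
theorem IsCgBessel.exists_analysis {μ : Measure Ω} {Λ : Ω → F →L[ℂ] E} {B : ℝ}
    (h : IsCgBessel μ Λ B) :
    ∃ T : F →L[ℂ] Lp E 2 μ, ∀ f, T f =ᵐ[μ] fun ω => Λ ω f := by
  have hmem : ∀ f, MemLp (fun ω => Λ ω f) 2 μ := fun f => by
    refine ⟨(h.1 f).aestronglyMeasurable, ?_⟩
    have h2 : eLpNorm (fun ω => Λ ω f) 2 μ ^ 2 < ∞ :=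
      (eLpNorm_two_sq_eq_lintegral μ _).trans_lt ((h.2 f).trans_lt ENNReal.ofReal_lt_top)
    exact (ENNReal.pow_lt_top_iff.1 h2).resolve_right two_ne_zero
  let T : F →ₗ[ℂ] Lp E 2 μ :=
    { toFun := fun f => (hmem f).toLp
      map_add' := fun f g => by
        rw [← MemLp.toLp_add]
        exact MemLp.toLp_congr _ _ (.of_forall fun ω => by simp)
      map_smul' := fun c f => by
        rw [RingHom.id_apply, ← MemLp.toLp_const_smul]
        exact MemLp.toLp_congr _ _ (.of_forall fun ω => by simp) }
  have hT : ∀ f, T f =ᵐ[μ] fun ω => Λ ω f := fun f => (hmem f).coeFn_toLp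
  refine ⟨T.mkContinuous (√|B|) fun f => ?_, hT⟩
  have hle := (ofReal_norm_sq_eq_lintegral (T f) (hT f)).trans_le (h.2 f)
  have hle' : ENNReal.ofReal (‖T f‖ ^ 2) ≤ ENNReal.ofReal (|B| * ‖f‖ ^ 2) :=
    hle.trans (ENNReal.ofReal_le_ofReal (by gcongr; exact le_abs_self B))
  rw [ENNReal.ofReal_le_ofReal_iff (by positivity)] at hle'
  refine le_of_sq_le_sq ?_ (by positivity)
  rwa [mul_pow, Real.sq_sqrt (abs_nonneg B)]

theorem IsCgFrame.isCgBessel {μ : Measure Ω} {Λ : Ω → F →L[ℂ] E} {A B : ℝ}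
    (h : IsCgFrame μ Λ A B) : IsCgBessel μ Λ B :=
  ⟨h.1, fun f => (h.2 f).2⟩

theorem IsCgFrame.le_norm_sq {μ : Measure Ω} {Λ : Ω → F →L[ℂ] E} {A B : ℝ}
    (h : IsCgFrame μ Λ A B) {T : F →L[ℂ] Lp E 2 μ} (hT : ∀ f, T f =ᵐ[μ] fun ω => Λ ω f)
    (f : F) : A * ‖f‖ ^ 2 ≤ ‖T f‖ ^ 2 := by
  have := (h.2 f).1
  rwa [← ofReal_norm_sq_eq_lintegral (T f) (hT f),
    ENNReal.ofReal_le_ofReal_iff (by positivity)] at this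

theorem isCgParseval_iff_norm {μ : Measure Ω} {Λ : Ω → F →L[ℂ] E}
    (hΛ : ∀ f, StronglyMeasurable fun ω => Λ ω f)
    {T : F → Lp E 2 μ} (hT : ∀ f, T f =ᵐ[μ] fun ω => Λ ω f) :
    IsCgParseval μ Λ ↔ ∀ f, ‖T f‖ = ‖f‖ := by
  rw [IsCgParseval, and_iff_right hΛ]
  refine forall_congr' fun f => ?_
  rw [← ofReal_norm_sq_eq_lintegral (T f) (hT f),
    ENNReal.ofReal_eq_ofReal_iff (by positivity) (by positivity),
    sq_eq_sq₀ (norm_nonneg _) (norm_nonneg _)]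

theorem stronglyDisjoint_iff_inner {μ : Measure Ω} {Λ : Ω → F →L[ℂ] E} {Θ : Ω → G →L[ℂ] E}
    {T : F →L[ℂ] Lp E 2 μ} {U : G →L[ℂ] Lp E 2 μ}
    (hT : ∀ f, T f =ᵐ[μ] fun ω => Λ ω f) (hU : ∀ f, U f =ᵐ[μ] fun ω => Θ ω f) :
    StronglyDisjoint μ Λ Θ ↔ ∀ h k, ⟪T h, U k⟫ = 0 := by
  refine forall₂_congr fun h k => ?_
  rw [L2.inner_def]
  refine Eq.congr_left (integral_congr_ae ?_)
  filter_upwards [hT h, hU k] with ω h₁ h₂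
  rw [h₁, h₂]

/-- A bounded below operator between Hilbert spaces becomes isometric after composition with
`(T* T) ^ (-1/2)`. -/
theorem exists_equiv_norm_comp_eq [CompleteSpace F] {V : Type*} [NormedAddCommGroup V] [InnerProductSpace ℂ V]
    [CompleteSpace V] (T : F →L[ℂ] V) {A : ℝ} (hA : 0 < A)
    (hT : ∀ f, A * ‖f‖ ^ 2 ≤ ‖T f‖ ^ 2) :
    ∃ L : F ≃L[ℂ] F, ∀ f, ‖T (L f)‖ = ‖f‖ := by
  set S : F →L[ℂ] F := (ContinuousLinearMap.adjoint T).comp T with hS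
  have hpos : 0 ≤ S :=
    (ContinuousLinearMap.nonneg_iff_isPositive S).2
      (ContinuousLinearMap.isPositive_adjoint_comp_self T)
  have hinner : ∀ f, ⟪S f, f⟫ = (‖T f‖ : ℂ) ^ 2 := fun f => by
    rw [hS, ContinuousLinearMap.comp_apply, ContinuousLinearMap.adjoint_inner_left,
      inner_self_eq_norm_sq_to_K]
    rfl
  have hunit : IsUnit S :=
    ContinuousLinearMap.isUnit_of_forall_le_norm_inner_map S (c := ⟨A, hA.le⟩) hA fun f => by
      rw [hinner, norm_pow, Complex.norm_real, norm_norm, mul_comm]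
      exact hT f
  have hsp : IsStrictlyPositive S := hunit.isStrictlyPositive hpos
  set R : F →L[ℂ] F := S ^ (-(1 / 2) : ℝ)
  have hR : R * S * R = 1 := CFC.conjugate_rpow_neg_one_half S hsp
  have hRunit : IsUnit R := (CFC.isUnit_rpow_iff S _ (by norm_num) hpos).2 hunit
  have hRsa : IsSelfAdjoint R := IsSelfAdjoint.of_nonneg CFC.rpow_nonneg
  obtain ⟨u, hu⟩ := hRunit
  refine ⟨ContinuousLinearEquiv.ofUnit u, fun f => ?_⟩
  have hL : ContinuousLinearEquiv.ofUnit u f = R f := by rw [← hu]; rfl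
  rw [hL]
  have h1 : ⟪S (R f), R f⟫ = ⟪f, f⟫ := by
    rw [← ContinuousLinearMap.adjoint_inner_left, hRsa.adjoint_eq]
    exact congrArg (fun x => ⟪x, f⟫) (DFunLike.congr_fun hR f)
  rw [hinner, inner_self_eq_norm_sq_to_K] at h1
  rw [← sq_eq_sq₀ (norm_nonneg _) (norm_nonneg _)]
  exact Complex.ofReal_injective (by push_cast; exact h1)

/-- Two isometries add up to an isometry on the Hilbert direct sum iff their ranges are
orthogonal. -/
theorem forall_norm_add_eq_iff_inner_eq_zero {V : Type*} [NormedAddCommGroup V]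
    [InnerProductSpace ℂ V] {T : F →L[ℂ] V} {U : G →L[ℂ] V}
    (hT : ∀ h, ‖T h‖ = ‖h‖) (hU : ∀ k, ‖U k‖ = ‖k‖) :
    (∀ x : WithLp 2 (F × G), ‖T x.fst + U x.snd‖ = ‖x‖) ↔ ∀ h k, ⟪T h, U k⟫ = 0 := by
  have key : ∀ x : WithLp 2 (F × G),
      ‖T x.fst + U x.snd‖ = ‖x‖ ↔ RCLike.re ⟪T x.fst, U x.snd⟫ = 0 := fun x => by
    rw [← sq_eq_sq₀ (norm_nonneg _) (norm_nonneg _), WithLp.prod_norm_sq_eq_of_L2,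
      norm_add_sq (𝕜 := ℂ), hT, hU]
    constructor <;> intro h <;> linarith
  simp_rw [key]
  refine ⟨fun hx h k => ?_, fun hx x => by rw [hx, map_zero]⟩
  have h1 := hx (WithLp.toLp 2 (h, k))
  have h2 := hx (WithLp.toLp 2 (Complex.I • h, k))
  simp only [WithLp.toLp_fst, WithLp.toLp_snd, map_smul, inner_smul_left] at h1 h2
  refine Complex.ext h1 ?_
  simpa using h2

end Analysis

variable {H K E : Type*}
  [NormedAddCommGroup H] [InnerProductSpace ℂ H] [CompleteSpace H]
  [NormedAddCommGroup K] [InnerProductSpace ℂ K] [CompleteSpace K]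
  [NormedAddCommGroup E] [InnerProductSpace ℂ E] [CompleteSpace E]

/-- `Λ` and `Θ` are strongly disjoint iff there exist invertible operators
`L₁ ∈ B(H)`, `L₂ ∈ B(K)` such that `{Λ_ω L₁}`, `{Θ_ω L₂}` and `{Δ_ω}`,
`Δ_ω (h ⊕ k) = Λ_ω L₁ h + Θ_ω L₂ k`, are Parseval continuous g-frames. -/
theorem stmt0 (μ : Measure Ω) (Λ : Ω → H →L[ℂ] E) (Θ : Ω → K →L[ℂ] E)
    (AL BL AT BT : ℝ) (hAL : 0 < AL) (hAT : 0 < AT)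
    (hL : IsCgFrame μ Λ AL BL) (hT : IsCgFrame μ Θ AT BT) :
    StronglyDisjoint μ Λ Θ ↔
      ∃ (L₁ : H ≃L[ℂ] H) (L₂ : K ≃L[ℂ] K),
        IsCgParseval μ (fun ω => (Λ ω).comp (L₁ : H →L[ℂ] H)) ∧
        IsCgParseval μ (fun ω => (Θ ω).comp (L₂ : K →L[ℂ] K)) ∧
        IsCgParseval μ (fun ω =>
          pairMap ((Λ ω).comp (L₁ : H →L[ℂ] H)) ((Θ ω).comp (L₂ : K →L[ℂ] K))) := by
  obtain ⟨T, hTΛ⟩ := hL.isCgBessel.exists_analysis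
  obtain ⟨U, hUΘ⟩ := hT.isCgBessel.exists_analysis
  have hadd : ∀ (L₁ : H ≃L[ℂ] H) (L₂ : K ≃L[ℂ] K) (x : WithLp 2 (H × K)),
      ⇑(T (L₁ x.fst) + U (L₂ x.snd)) =ᵐ[μ] fun ω =>
        pairMap ((Λ ω).comp (L₁ : H →L[ℂ] H)) ((Θ ω).comp (L₂ : K →L[ℂ] K)) x :=
    fun L₁ L₂ x => (Lp.coeFn_add _ _).trans ((hTΛ (L₁ x.fst)).add (hUΘ (L₂ x.snd)))
  have hmeas : ∀ (L₁ : H ≃L[ℂ] H) (L₂ : K ≃L[ℂ] K) (x : WithLp 2 (H × K)),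
      StronglyMeasurable fun ω =>
        pairMap ((Λ ω).comp (L₁ : H →L[ℂ] H)) ((Θ ω).comp (L₂ : K →L[ℂ] K)) x :=
    fun L₁ L₂ x => (hL.1 (L₁ x.fst)).add (hT.1 (L₂ x.snd))
  have hpar : ∀ (L₁ : H ≃L[ℂ] H) (L₂ : K ≃L[ℂ] K),
      (IsCgParseval μ (fun ω => (Λ ω).comp (L₁ : H →L[ℂ] H)) ↔ ∀ h, ‖T (L₁ h)‖ = ‖h‖) ∧
      (IsCgParseval μ (fun ω => (Θ ω).comp (L₂ : K →L[ℂ] K)) ↔ ∀ k, ‖U (L₂ k)‖ = ‖k‖) ∧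
      (IsCgParseval μ (fun ω =>
          pairMap ((Λ ω).comp (L₁ : H →L[ℂ] H)) ((Θ ω).comp (L₂ : K →L[ℂ] K))) ↔
        ∀ x : WithLp 2 (H × K), ‖T (L₁ x.fst) + U (L₂ x.snd)‖ = ‖x‖) :=
    fun L₁ L₂ => ⟨isCgParseval_iff_norm (fun f => hL.1 (L₁ f)) fun f => hTΛ (L₁ f),
      isCgParseval_iff_norm (fun f => hT.1 (L₂ f)) fun f => hUΘ (L₂ f),
      isCgParseval_iff_norm (hmeas L₁ L₂) (hadd L₁ L₂)⟩
  rw [stronglyDisjoint_iff_inner hTΛ hUΘ]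
  constructor
  · intro hdisj
    obtain ⟨L₁, h₁⟩ := exists_equiv_norm_comp_eq T hAL (hL.le_norm_sq hTΛ)
    obtain ⟨L₂, h₂⟩ := exists_equiv_norm_comp_eq U hAT (hT.le_norm_sq hUΘ)
    obtain ⟨e₁, e₂, e₃⟩ := hpar L₁ L₂
    exact ⟨L₁, L₂, e₁.2 h₁, e₂.2 h₂, e₃.2 <|
      (forall_norm_add_eq_iff_inner_eq_zero (T := T.comp (L₁ : H →L[ℂ] H))
        (U := U.comp (L₂ : K →L[ℂ] K)) h₁ h₂).2 fun h k => hdisj (L₁ h) (L₂ k)⟩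
  · rintro ⟨L₁, L₂, p₁, p₂, p₃⟩ h k
    obtain ⟨e₁, e₂, e₃⟩ := hpar L₁ L₂
    have := (forall_norm_add_eq_iff_inner_eq_zero (T := T.comp (L₁ : H →L[ℂ] H))
      (U := U.comp (L₂ : K →L[ℂ] K)) (e₁.1 p₁) (e₂.1 p₂)).1 (e₃.1 p₃) (L₁.symm h) (L₂.symm k)
    simpa using this
end
end

section
/- Let Λ = {Λ_ω ∈ B(H,E) : ω ∈ Ω} and Θ = {Θ_ω ∈ B(H,E) : ω ∈ Ω} be strongly disjoint continuous g-frames for H with respect to E, and let L₁, L₂ ∈ B(H) satisfy L₁* L₁ + L₂* L₂ = A·I for some constant A > 0. Then {Λ_ω L₁ + Θ_ω L₂ : ω ∈ Ω} is a continuous g-frame for H with respect to E (with lower bound A·min{A_Λ, A_Θ} and upper bound B_Λ‖L₁‖² + B_Θ‖L₂‖²). -/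
open MeasureTheory
open scoped ENNReal NNReal Pointwise

noncomputable section

local notation "⟪" x ", " y "⟫" => @inner ℂ _ _ x y

variable {Ω : Type*} [MeasurableSpace Ω]

section Pythagoras

variable {H E : Type*}
  [NormedAddCommGroup H] [InnerProductSpace ℂ H]
  [NormedAddCommGroup E] [InnerProductSpace ℂ E]

theorem memLp_two_of_lintegral_nnnorm_sq_lt_top {E : Type*} [NormedAddCommGroup E]
    {μ : Measure Ω} {u : Ω → E}
    (hu : AEStronglyMeasurable u μ) (h : ∫⁻ ω, (‖u ω‖₊ : ℝ≥0∞) ^ 2 ∂μ < ∞) : MemLp u 2 μ := by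
  refine ⟨hu, ?_⟩
  rw [eLpNorm_lt_top_iff_lintegral_rpow_enorm_lt_top two_ne_zero ENNReal.ofNat_ne_top]
  simpa [enorm_eq_nnnorm] using h

/-- Pythagoras in `L²`, for Lebesgue integrals. -/
theorem lintegral_nnnorm_add_sq_of_integral_inner_eq_zero {μ : Measure Ω} {u v : Ω → E}
    (hu : MemLp u 2 μ) (hv : MemLp v 2 μ) (h : ∫ ω, ⟪u ω, v ω⟫ ∂μ = 0) :
    ∫⁻ ω, (‖u ω + v ω‖₊ : ℝ≥0∞) ^ 2 ∂μ =
      ∫⁻ ω, (‖u ω‖₊ : ℝ≥0∞) ^ 2 ∂μ + ∫⁻ ω, (‖v ω‖₊ : ℝ≥0∞) ^ 2 ∂μ := by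
  have key : ∀ w : Ω → E, MemLp w 2 μ →
      ∫⁻ ω, (‖w ω‖₊ : ℝ≥0∞) ^ 2 ∂μ = ENNReal.ofReal (∫ ω, ‖w ω‖ ^ 2 ∂μ) := by
    intro w hw
    rw [ofReal_integral_eq_lintegral_ofReal hw.norm.integrable_sq
      (Filter.Eventually.of_forall fun ω => sq_nonneg _)]
    refine lintegral_congr fun ω => ?_
    rw [ENNReal.ofReal_pow (norm_nonneg _), ofReal_norm, enorm_eq_nnnorm]
  have hint : Integrable (fun ω => ⟪u ω, v ω⟫) μ := by
    refine (L2.integrable_inner (𝕜 := ℂ) (hu.toLp u) (hv.toLp v)).congr ?_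
    filter_upwards [hu.coeFn_toLp, hv.coeFn_toLp] with ω h₁ h₂
    rw [h₁, h₂]
  have hre : ∫ ω, RCLike.re ⟪u ω, v ω⟫ ∂μ = 0 := by
    rw [integral_re hint, h, map_zero]
  have hsum := key _ (hu.add hv)
  simp only [Pi.add_apply] at hsum
  rw [hsum, key u hu, key v hv, ← ENNReal.ofReal_add (by positivity) (by positivity)]
  congr 1
  simp_rw [norm_add_sq (𝕜 := ℂ)]
  have hre_int : Integrable (fun ω => 2 * RCLike.re ⟪u ω, v ω⟫) μ := hint.re.const_mul 2
  have huv : Integrable (fun ω => ‖u ω‖ ^ 2 + 2 * RCLike.re ⟪u ω, v ω⟫) μ :=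
    hu.norm.integrable_sq.add hre_int
  rw [integral_add huv hv.norm.integrable_sq,
    integral_add hu.norm.integrable_sq hre_int, integral_const_mul, hre, mul_zero, add_zero]

theorem IsCgFrame.memLp {μ : Measure Ω} {Λ : Ω → H →L[ℂ] E} {A B : ℝ} (h : IsCgFrame μ Λ A B)
    (f : H) : MemLp (fun ω => Λ ω f) 2 μ :=
  memLp_two_of_lintegral_nnnorm_sq_lt_top (h.1 f).aestronglyMeasurable
    ((h.2 f).2.trans_lt ENNReal.ofReal_lt_top)

theorem IsCgFrame.le_of_ne_zero {μ : Measure Ω} {Λ : Ω → H →L[ℂ] E} {A B : ℝ} (hA : 0 < A)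
    (h : IsCgFrame μ Λ A B) {f : H} (hf : f ≠ 0) : A ≤ B := by
  have hf' : 0 < ‖f‖ ^ 2 := by positivity
  have := (ENNReal.ofReal_le_ofReal_iff' (p := A * ‖f‖ ^ 2)).1 ((h.2 f).1.trans (h.2 f).2)
  rcases this with this | this
  · exact le_of_mul_le_mul_right this hf'
  · exact absurd this (not_le.2 (by positivity))

theorem norm_sq_add_norm_sq_of_adjoint_comp_add [CompleteSpace H]
    {L₁ L₂ : H →L[ℂ] H} {A : ℝ}
    (hsum : (ContinuousLinearMap.adjoint L₁).comp L₁ + (ContinuousLinearMap.adjoint L₂).comp L₂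
      = (A : ℂ) • ContinuousLinearMap.id ℂ H) (f : H) :
    ‖L₁ f‖ ^ 2 + ‖L₂ f‖ ^ 2 = A * ‖f‖ ^ 2 := by
  have h := congrArg (fun T : H →L[ℂ] H => RCLike.re ⟪f, T f⟫) hsum
  simpa [inner_add_right, ContinuousLinearMap.adjoint_inner_right, inner_smul_right,
    ← Complex.ofReal_pow, ← Complex.ofReal_mul] using h

end Pythagoras

variable {H K E : Type*}
  [NormedAddCommGroup H] [InnerProductSpace ℂ H] [CompleteSpace H]
  [NormedAddCommGroup K] [InnerProductSpace ℂ K] [CompleteSpace K]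
  [NormedAddCommGroup E] [InnerProductSpace ℂ E] [CompleteSpace E]

/-- if `Λ`, `Θ` are strongly disjoint continuous g-frames and
`L₁* L₁ + L₂* L₂ = A • I` with `A > 0`, then `{Λ_ω L₁ + Θ_ω L₂}` is a continuous g-frame
with bounds `A·min{A_Λ, A_Θ}` and `B_Λ‖L₁‖² + B_Θ‖L₂‖²`. -/
theorem stmt7 (μ : Measure Ω) (Λ Θ : Ω → H →L[ℂ] E)
    (AL BL AT BT : ℝ) (hAL : 0 < AL) (hAT : 0 < AT)
    (hL : IsCgFrame μ Λ AL BL) (hT : IsCgFrame μ Θ AT BT)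
    (hdis : StronglyDisjoint μ Λ Θ) (L₁ L₂ : H →L[ℂ] H) (A : ℝ) (hA : 0 < A)
    (hsum : (ContinuousLinearMap.adjoint L₁).comp L₁ + (ContinuousLinearMap.adjoint L₂).comp L₂
      = (A : ℂ) • ContinuousLinearMap.id ℂ H) :
    IsCgFrame μ (fun ω => (Λ ω).comp L₁ + (Θ ω).comp L₂)
      (A * min AL AT) (BL * ‖L₁‖ ^ 2 + BT * ‖L₂‖ ^ 2) := by
  refine ⟨fun f => (hL.1 (L₁ f)).add (hT.1 (L₂ f)), fun f => ?_⟩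
  have hpyth := lintegral_nnnorm_add_sq_of_integral_inner_eq_zero (hL.memLp (L₁ f))
    (hT.memLp (L₂ f)) (hdis (L₁ f) (L₂ f))
  simp only [add_apply, ContinuousLinearMap.comp_apply]
  rw [hpyth]
  have hnorm := norm_sq_add_norm_sq_of_adjoint_comp_add hsum f
  refine ⟨?_, ?_⟩
  · refine le_trans ?_ (add_le_add (hL.2 (L₁ f)).1 (hT.2 (L₂ f)).1)
    rw [← ENNReal.ofReal_add (by positivity) (by positivity)]
    refine ENNReal.ofReal_le_ofReal ?_
    calc A * min AL AT * ‖f‖ ^ 2 = min AL AT * ‖L₁ f‖ ^ 2 + min AL AT * ‖L₂ f‖ ^ 2 := by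
          rw [← mul_add, hnorm]; ring
      _ ≤ AL * ‖L₁ f‖ ^ 2 + AT * ‖L₂ f‖ ^ 2 := by
          gcongr
          exacts [min_le_left _ _, min_le_right _ _]
  · refine (add_le_add (hL.2 (L₁ f)).2 (hT.2 (L₂ f)).2).trans ?_
    rcases eq_or_ne f 0 with rfl | hf
    · simp
    have hBL : 0 ≤ BL := hAL.le.trans (hL.le_of_ne_zero hAL hf)
    have hBT : 0 ≤ BT := hAT.le.trans (hT.le_of_ne_zero hAT hf)
    rw [← ENNReal.ofReal_add (by positivity) (by positivity)]
    refine ENNReal.ofReal_le_ofReal ?_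
    calc BL * ‖L₁ f‖ ^ 2 + BT * ‖L₂ f‖ ^ 2
        ≤ BL * (‖L₁‖ * ‖f‖) ^ 2 + BT * (‖L₂‖ * ‖f‖) ^ 2 := by
          gcongr
          exacts [L₁.le_opNorm f, L₂.le_opNorm f]
      _ = (BL * ‖L₁‖ ^ 2 + BT * ‖L₂‖ ^ 2) * ‖f‖ ^ 2 := by ring
end
end

section
/- Let Λ = {Λ_ω ∈ B(H,E) : ω ∈ Ω} and Θ = {Θ_ω ∈ B(H,E) : ω ∈ Ω} be strongly disjoint Parseval continuous g-frames for H with respect to E, and let L₁, L₂ ∈ B(H). Then L₁* L₁ + L₂* L₂ = A·I for some A > 0 if and only if {Λ_ω L₁ + Θ_ω L₂ : ω ∈ Ω} is a tight continuous g-frame with bound A, i.e. ∫_Ω ‖(Λ_ω L₁ + Θ_ω L₂)h‖² dμ(ω) = A‖h‖² for all h ∈ H. -/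
open MeasureTheory
open scoped ENNReal NNReal Pointwise

noncomputable section

local notation "⟪" x ", " y "⟫" => @inner ℂ _ _ x y

variable {Ω : Type*} [MeasurableSpace Ω]

variable {H K E : Type*}
  [NormedAddCommGroup H] [InnerProductSpace ℂ H] [CompleteSpace H]
  [NormedAddCommGroup K] [InnerProductSpace ℂ K] [CompleteSpace K]
  [NormedAddCommGroup E] [InnerProductSpace ℂ E] [CompleteSpace E]

theorem lintegral_sq_nnnorm_eq_ofReal_integral {V : Type*} [NormedAddCommGroup V]
    {μ : Measure Ω} {f : Ω → V} (hf : MemLp f 2 μ) :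
    ∫⁻ ω, (‖f ω‖₊ : ℝ≥0∞) ^ 2 ∂μ = ENNReal.ofReal (∫ ω, ‖f ω‖ ^ 2 ∂μ) := by
  rw [ofReal_integral_eq_lintegral_ofReal (hf.integrable_norm_pow two_ne_zero)
    (Filter.Eventually.of_forall fun ω => by positivity)]
  refine lintegral_congr fun ω => ?_
  rw [ENNReal.ofReal_pow (norm_nonneg _), ofReal_norm, enorm_eq_nnnorm]

theorem IsCgParseval.memLp {F E' : Type*}
    [NormedAddCommGroup F] [InnerProductSpace ℂ F]
    [NormedAddCommGroup E'] [InnerProductSpace ℂ E']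
    {μ : Measure Ω} {Λ : Ω → F →L[ℂ] E'} (hΛ : IsCgParseval μ Λ) (f : F) :
    MemLp (fun ω => Λ ω f) 2 μ := by
  refine ⟨(hΛ.1 f).aestronglyMeasurable, ?_⟩
  rw [eLpNorm_lt_top_iff_lintegral_rpow_enorm_lt_top two_ne_zero ENNReal.ofNat_ne_top]
  simp only [ENNReal.toReal_ofNat, ENNReal.rpow_ofNat, enorm_eq_nnnorm]
  rw [hΛ.2 f]
  exact ENNReal.ofReal_lt_top

theorem IsCgParseval.integral_sq_norm {F E' : Type*}
    [NormedAddCommGroup F] [InnerProductSpace ℂ F]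
    [NormedAddCommGroup E'] [InnerProductSpace ℂ E']
    {μ : Measure Ω} {Λ : Ω → F →L[ℂ] E'} (hΛ : IsCgParseval μ Λ) (f : F) :
    ∫ ω, ‖Λ ω f‖ ^ 2 ∂μ = ‖f‖ ^ 2 := by
  have h := hΛ.2 f
  rwa [lintegral_sq_nnnorm_eq_ofReal_integral (hΛ.memLp f),
    ENNReal.ofReal_eq_ofReal_iff (integral_nonneg fun ω => by positivity) (by positivity)] at h

/-- For strongly disjoint Parseval families, `∫ ‖Λ_ω u + Θ_ω v‖² dμ(ω) = ‖u‖² + ‖v‖²`. -/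
theorem lintegral_sq_nnnorm_add_of_stronglyDisjoint {F G E' : Type*}
    [NormedAddCommGroup F] [InnerProductSpace ℂ F]
    [NormedAddCommGroup G] [InnerProductSpace ℂ G]
    [NormedAddCommGroup E'] [InnerProductSpace ℂ E']
    {μ : Measure Ω} {Λ : Ω → F →L[ℂ] E'} {Θ : Ω → G →L[ℂ] E'}
    (hL : IsCgParseval μ Λ) (hT : IsCgParseval μ Θ) (hdis : StronglyDisjoint μ Λ Θ)
    (u : F) (v : G) :
    ∫⁻ ω, (‖Λ ω u + Θ ω v‖₊ : ℝ≥0∞) ^ 2 ∂μ = ENNReal.ofReal (‖u‖ ^ 2 + ‖v‖ ^ 2) := by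
  have hu := hL.memLp u
  have hv := hT.memLp v
  have hinner : Integrable (fun ω => ⟪Λ ω u, Θ ω v⟫) μ := by
    refine (hu.norm.integrable_mul hv.norm).mono' (hu.1.inner hv.1) ?_
    exact Filter.Eventually.of_forall fun ω => norm_inner_le_norm _ _
  have hre : ∫ ω, RCLike.re ⟪Λ ω u, Θ ω v⟫ ∂μ = 0 := by
    rw [integral_re hinner, hdis u v, map_zero]
  have hsum : MemLp (fun ω => Λ ω u + Θ ω v) 2 μ := hu.add hv
  have hIu := hu.integrable_norm_pow two_ne_zero
  have hIv := hv.integrable_norm_pow two_ne_zero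
  rw [lintegral_sq_nnnorm_eq_ofReal_integral hsum]
  congr 1
  simp only [norm_add_sq (𝕜 := ℂ)]
  have hsplit : ∫ ω, ‖Λ ω u‖ ^ 2 + 2 * RCLike.re ⟪Λ ω u, Θ ω v⟫ + ‖Θ ω v‖ ^ 2 ∂μ =
      ∫ ω, ‖Λ ω u‖ ^ 2 ∂μ + ∫ ω, 2 * RCLike.re ⟪Λ ω u, Θ ω v⟫ ∂μ + ∫ ω, ‖Θ ω v‖ ^ 2 ∂μ := by
    have hcross := hinner.re.const_mul 2
    exact (integral_add (hIu.add hcross) hIv).trans (by rw [integral_add' hIu hcross])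
  rw [hsplit, integral_const_mul, hre, hL.integral_sq_norm, hT.integral_sq_norm]
  ring

/-- `L₁* L₁ + L₂* L₂ = a • I` exactly when `‖L₁ h‖² + ‖L₂ h‖² = a ‖h‖²` for all `h`. -/
theorem adjoint_comp_self_add_eq_smul_id_iff {V : Type*}
    [NormedAddCommGroup V] [InnerProductSpace ℂ V] [CompleteSpace V]
    (L₁ L₂ : V →L[ℂ] V) (a : ℝ) :
    (ContinuousLinearMap.adjoint L₁).comp L₁ + (ContinuousLinearMap.adjoint L₂).comp L₂
        = (a : ℂ) • ContinuousLinearMap.id ℂ V ↔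
      ∀ h : V, ‖L₁ h‖ ^ 2 + ‖L₂ h‖ ^ 2 = a * ‖h‖ ^ 2 := by
  rw [← ContinuousLinearMap.coe_inj, ← ext_inner_map]
  refine forall_congr' fun h => ?_
  simp only [ContinuousLinearMap.coe_coe, add_apply, ContinuousLinearMap.comp_apply,
    smul_apply, ContinuousLinearMap.id_apply, inner_add_left,
    ContinuousLinearMap.adjoint_inner_left, inner_self_eq_norm_sq_to_K, inner_smul_left,
    Complex.conj_ofReal, Complex.coe_algebraMap]
  norm_cast

/-- if `Λ`, `Θ` are strongly disjoint Parseval continuous g-frames and `A > 0`,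
then `L₁* L₁ + L₂* L₂ = A • I` iff `{Λ_ω L₁ + Θ_ω L₂}` is a tight continuous g-frame with
bound `A`. -/
theorem stmt9 (μ : Measure Ω) (Λ Θ : Ω → H →L[ℂ] E)
    (hL : IsCgParseval μ Λ) (hT : IsCgParseval μ Θ)
    (hdis : StronglyDisjoint μ Λ Θ) (L₁ L₂ : H →L[ℂ] H) (A : ℝ) (hA : 0 < A) :
    (ContinuousLinearMap.adjoint L₁).comp L₁ + (ContinuousLinearMap.adjoint L₂).comp L₂
        = (A : ℂ) • ContinuousLinearMap.id ℂ H ↔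
      IsCgTight μ (fun ω => (Λ ω).comp L₁ + (Θ ω).comp L₂) A := by
  rw [adjoint_comp_self_add_eq_smul_id_iff]
  have hmeas : ∀ h : H, StronglyMeasurable fun ω => ((Λ ω).comp L₁ + (Θ ω).comp L₂) h :=
    fun h => (hL.1 (L₁ h)).add (hT.1 (L₂ h))
  refine Iff.trans (forall_congr' fun h => ?_) (and_iff_right hmeas).symm
  simp only [add_apply, ContinuousLinearMap.comp_apply]
  rw [lintegral_sq_nnnorm_add_of_stronglyDisjoint hL hT hdis,
    ENNReal.ofReal_eq_ofReal_iff (by positivity) (by positivity)]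
end
end

section
/- Let Λ = {Λ_ω ∈ B(H,E) : ω ∈ Ω} and Θ = {Θ_ω ∈ B(H,E) : ω ∈ Ω} be strongly disjoint Parseval continuous g-frames for H with respect to E, and let L₁, L₂ ∈ B(H). Then L₁* L₁ + L₂* L₂ = I if and only if {Λ_ω L₁ + Θ_ω L₂ : ω ∈ Ω} is a Parseval continuous g-frame for H with respect to E. -/
open MeasureTheory
open scoped ENNReal NNReal Pointwise

noncomputable section

local notation "⟪" x ", " y "⟫" => @inner ℂ _ _ x y

variable {Ω : Type*} [MeasurableSpace Ω]

/-- Pythagoras in `L²(μ; E)`, in terms of lower Lebesgue integrals. -/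
theorem lintegral_nnnorm_add_sq_of_integral_inner_eq_zero_s10 {X V : Type*} [MeasurableSpace X]
    [NormedAddCommGroup V] [InnerProductSpace ℂ V] {μ : Measure X} {x y : X → V} {a b : ℝ}
    (hx : AEStronglyMeasurable x μ) (hy : AEStronglyMeasurable y μ) (ha : 0 ≤ a) (hb : 0 ≤ b)
    (hxa : ∫⁻ ω, (‖x ω‖₊ : ℝ≥0∞) ^ 2 ∂μ = ENNReal.ofReal a)
    (hyb : ∫⁻ ω, (‖y ω‖₊ : ℝ≥0∞) ^ 2 ∂μ = ENNReal.ofReal b)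
    (hxy : ∫ ω, ⟪x ω, y ω⟫ ∂μ = 0) :
    ∫⁻ ω, (‖x ω + y ω‖₊ : ℝ≥0∞) ^ 2 ∂μ = ENNReal.ofReal (a + b) := by
  have sq_eq : ∀ v : V, (‖v‖₊ : ℝ≥0∞) ^ 2 = ENNReal.ofReal (‖v‖ ^ 2) := fun v => by
    rw [ENNReal.ofReal_pow (norm_nonneg v), ofReal_norm]; rfl
  have integrable_sq : ∀ {z : X → V} {c : ℝ}, AEStronglyMeasurable z μ →
      ∫⁻ ω, (‖z ω‖₊ : ℝ≥0∞) ^ 2 ∂μ = ENNReal.ofReal c →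
      Integrable (fun ω => ‖z ω‖ ^ 2) μ := by
    intro z c hz hzc
    refine ⟨hz.norm.pow 2, ?_⟩
    rw [hasFiniteIntegral_iff_ofReal (.of_forall fun _ => by positivity)]
    simp only [← sq_eq, hzc, ENNReal.ofReal_lt_top]
  have integral_sq : ∀ {z : X → V} {c : ℝ}, AEStronglyMeasurable z μ → 0 ≤ c →
      ∫⁻ ω, (‖z ω‖₊ : ℝ≥0∞) ^ 2 ∂μ = ENNReal.ofReal c → ∫ ω, ‖z ω‖ ^ 2 ∂μ = c := by
    intro z c hz hc hzc
    rw [integral_eq_lintegral_of_nonneg_ae (.of_forall fun _ => sq_nonneg _)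
      (integrable_sq hz hzc).aestronglyMeasurable]
    simp only [← sq_eq, hzc, ENNReal.toReal_ofReal hc]
  have hix := integrable_sq hx hxa
  have hiy := integrable_sq hy hyb
  have hinner : Integrable (fun ω => ⟪x ω, y ω⟫) μ := by
    refine (hix.add hiy).mono' (hx.inner hy) (.of_forall fun ω => ?_)
    have h := norm_inner_le_norm (𝕜 := ℂ) (x ω) (y ω)
    simp only [Pi.add_apply]
    nlinarith [sq_nonneg (‖x ω‖ - ‖y ω‖), sq_nonneg ‖x ω‖, sq_nonneg ‖y ω‖]
  have hcross : Integrable (fun ω => 2 * RCLike.re ⟪x ω, y ω⟫) μ := hinner.re.const_mul 2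
  have hexpand : ∀ ω, ‖x ω + y ω‖ ^ 2 = ‖x ω‖ ^ 2 + 2 * RCLike.re ⟪x ω, y ω⟫ + ‖y ω‖ ^ 2 :=
    fun ω => norm_add_sq (𝕜 := ℂ) (x ω) (y ω)
  have hxcross : Integrable (fun ω => ‖x ω‖ ^ 2 + 2 * RCLike.re ⟪x ω, y ω⟫) μ := hix.add hcross
  have hsum : Integrable (fun ω => ‖x ω + y ω‖ ^ 2) μ := by
    simp only [hexpand]
    exact hxcross.add hiy
  simp only [sq_eq]
  rw [← ofReal_integral_eq_lintegral_ofReal hsum (.of_forall fun _ => by positivity)]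
  simp only [hexpand]
  rw [integral_add hxcross hiy, integral_add hix hcross, integral_const_mul,
    integral_re hinner, hxy, integral_sq hx ha hxa, integral_sq hy hb hyb]
  simp

/-- `L₁* L₁ + L₂* L₂ = I` iff the column operator `f ↦ (L₁ f, L₂ f)` is isometric. -/
theorem adjoint_comp_add_adjoint_comp_eq_id_iff {V W : Type*}
    [NormedAddCommGroup V] [InnerProductSpace ℂ V] [CompleteSpace V]
    [NormedAddCommGroup W] [InnerProductSpace ℂ W] [CompleteSpace W] (L₁ L₂ : V →L[ℂ] W) :
    (ContinuousLinearMap.adjoint L₁).comp L₁ + (ContinuousLinearMap.adjoint L₂).comp L₂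
        = ContinuousLinearMap.id ℂ V ↔
      ∀ f : V, ‖L₁ f‖ ^ 2 + ‖L₂ f‖ ^ 2 = ‖f‖ ^ 2 := by
  rw [← ContinuousLinearMap.coe_inj, ← ext_inner_map]
  refine forall_congr' fun f => ?_
  simp only [ContinuousLinearMap.coe_coe, add_apply,
    ContinuousLinearMap.comp_apply, ContinuousLinearMap.id_apply, inner_add_left,
    ContinuousLinearMap.adjoint_inner_left, inner_self_eq_norm_sq_to_K]
  norm_cast

variable {H K E : Type*}
  [NormedAddCommGroup H] [InnerProductSpace ℂ H] [CompleteSpace H]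
  [NormedAddCommGroup K] [InnerProductSpace ℂ K] [CompleteSpace K]
  [NormedAddCommGroup E] [InnerProductSpace ℂ E] [CompleteSpace E]

/-- if `Λ`, `Θ` are strongly disjoint Parseval continuous g-frames, then
`L₁* L₁ + L₂* L₂ = I` iff `{Λ_ω L₁ + Θ_ω L₂}` is a Parseval continuous g-frame. -/
theorem stmt10 (μ : Measure Ω) (Λ Θ : Ω → H →L[ℂ] E)
    (hL : IsCgParseval μ Λ) (hT : IsCgParseval μ Θ) (hdis : StronglyDisjoint μ Λ Θ)
    (L₁ L₂ : H →L[ℂ] H) :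
    (ContinuousLinearMap.adjoint L₁).comp L₁ + (ContinuousLinearMap.adjoint L₂).comp L₂
        = ContinuousLinearMap.id ℂ H ↔
      IsCgParseval μ (fun ω => (Λ ω).comp L₁ + (Θ ω).comp L₂) := by
  have key : ∀ f : H, ∫⁻ ω, (‖((Λ ω).comp L₁ + (Θ ω).comp L₂) f‖₊ : ℝ≥0∞) ^ 2 ∂μ
      = ENNReal.ofReal (‖L₁ f‖ ^ 2 + ‖L₂ f‖ ^ 2) := fun f =>
    lintegral_nnnorm_add_sq_of_integral_inner_eq_zero_s10
      (hL.1 (L₁ f)).aestronglyMeasurable (hT.1 (L₂ f)).aestronglyMeasurable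
      (by positivity) (by positivity) (hL.2 (L₁ f)) (hT.2 (L₂ f)) (hdis (L₁ f) (L₂ f))
  rw [adjoint_comp_add_adjoint_comp_eq_id_iff]
  refine ⟨fun h => ⟨fun f => (hL.1 (L₁ f)).add (hT.1 (L₂ f)), fun f => by rw [key, h]⟩,
    fun h f => ?_⟩
  have hf := h.2 f
  rwa [key, ENNReal.ofReal_eq_ofReal_iff (by positivity) (by positivity)] at hf
end
end

section
/- Let (Ω, μ) be a measure space with μ σ-finite, let Λ = {Λ_ω ∈ B(H,E) : ω ∈ Ω} be a continuous g-frame for H with respect to E, and let Θ = {Θ_ω ∈ B(K,E) : ω ∈ Ω} be a continuous g-Bessel family for K with respect to E. If the operator S_ΘΛ : H → K, determined by ⟨S_ΘΛ f, g⟩ = ∫_Ω ⟨Λ_ω f, Θ_ω g⟩ dμ(ω), is surjective, then Θ is a continuous g-frame for K with respect to E. -/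
open MeasureTheory
open scoped ENNReal NNReal Pointwise

noncomputable section

local notation "⟪" x ", " y "⟫" => @inner ℂ _ _ x y

variable {Ω : Type*} [MeasurableSpace Ω]

variable {H K E : Type*}
  [NormedAddCommGroup H] [InnerProductSpace ℂ H] [CompleteSpace H]
  [NormedAddCommGroup K] [InnerProductSpace ℂ K] [CompleteSpace K]
  [NormedAddCommGroup E] [InnerProductSpace ℂ E] [CompleteSpace E]

/-- The Cauchy–Schwarz inequality for the squared norm of an integral of inner products. -/
theorem enorm_integral_inner_sq_le {X V : Type*} [MeasurableSpace X]
    [NormedAddCommGroup V] [InnerProductSpace ℂ V] {ν : Measure X} {u v : X → V}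
    (hu : AEStronglyMeasurable u ν) (hv : AEStronglyMeasurable v ν) :
    ‖∫ x, ⟪u x, v x⟫ ∂ν‖ₑ ^ 2 ≤ (∫⁻ x, ‖u x‖ₑ ^ 2 ∂ν) * ∫⁻ x, ‖v x‖ₑ ^ 2 ∂ν := by
  have hroot (a : ℝ≥0∞) : (a ^ (1 / 2 : ℝ)) ^ 2 = a := by
    rw [← ENNReal.rpow_natCast, ← ENNReal.rpow_mul]
    norm_num
  have hcs : ‖∫ x, ⟪u x, v x⟫ ∂ν‖ₑ ≤
      (∫⁻ x, ‖u x‖ₑ ^ 2 ∂ν) ^ (1 / 2 : ℝ) * (∫⁻ x, ‖v x‖ₑ ^ 2 ∂ν) ^ (1 / 2 : ℝ) :=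
    calc ‖∫ x, ⟪u x, v x⟫ ∂ν‖ₑ
        ≤ ∫⁻ x, ‖⟪u x, v x⟫‖ₑ ∂ν := enorm_integral_le_lintegral_enorm _
      _ ≤ ∫⁻ x, ‖u x‖ₑ * ‖v x‖ₑ ∂ν := by
        refine lintegral_mono fun x => ?_
        simp only [enorm_eq_nnnorm, ← ENNReal.coe_mul, ENNReal.coe_le_coe]
        exact nnnorm_inner_le_nnnorm _ _
      _ ≤ _ := by
        simpa using ENNReal.lintegral_mul_le_Lp_mul_Lq ν Real.HolderConjugate.two_two
          hu.enorm hv.enorm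
  calc _ ≤ _ := pow_le_pow_left' hcs 2
    _ = _ := by rw [mul_pow, hroot, hroot]

/-- with `μ` σ-finite, `Λ` a continuous g-frame for `H` and `Θ` a continuous
g-Bessel family for `K`, if `S_ΘΛ` is surjective then `Θ` is a continuous g-frame. -/
theorem stmt17 (μ : Measure Ω) [SigmaFinite μ]
    (Λ : Ω → H →L[ℂ] E) (Θ : Ω → K →L[ℂ] E)
    (AL BL BT : ℝ) (hAL : 0 < AL) (hBT : 0 < BT)
    (hL : IsCgFrame μ Λ AL BL) (hT : IsCgBessel μ Θ BT)
    (STL : H →L[ℂ] K)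
    (hSTL : ∀ (f : H) (g : K), ⟪STL f, g⟫ = ∫ ω, ⟪Λ ω f, Θ ω g⟫ ∂μ)
    (hsurj : Function.Surjective ⇑STL) :
    ∃ A B : ℝ, 0 < A ∧ IsCgFrame μ Θ A B := by
  obtain ⟨C, hC, hpre⟩ := STL.exists_preimage_norm_le hsurj
  have hM : 0 < max BL 1 * C ^ 2 := by positivity
  refine ⟨(max BL 1 * C ^ 2)⁻¹, BT, inv_pos.2 hM, hT.1, fun g => ⟨?_, hT.2 g⟩⟩
  rcases eq_or_ne g 0 with rfl | hg
  · simp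
  obtain ⟨f, rfl, hf⟩ := hpre g
  have hg' : 0 < ‖STL f‖ := norm_pos_iff.2 hg
  have hfin : ∫⁻ ω, (‖Θ ω (STL f)‖₊ : ℝ≥0∞) ^ 2 ∂μ ≠ ∞ :=
    ((hT.2 _).trans_lt ENNReal.ofReal_lt_top).ne
  have hLf : ∫⁻ ω, (‖Λ ω f‖₊ : ℝ≥0∞) ^ 2 ∂μ ≤
      ENNReal.ofReal (max BL 1 * C ^ 2 * ‖STL f‖ ^ 2) := by
    refine (hL.2 f).2.trans (ENNReal.ofReal_le_ofReal ?_)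
    calc BL * ‖f‖ ^ 2 ≤ max BL 1 * (C * ‖STL f‖) ^ 2 := by
          gcongr
          exact le_max_left _ _
      _ = _ := by ring
  have hcs := enorm_integral_inner_sq_le (ν := μ) (hL.1 f).aestronglyMeasurable
    (hT.1 (STL f)).aestronglyMeasurable
  simp only [enorm_eq_nnnorm] at hcs
  replace hcs := hcs.trans (mul_le_mul_left hLf _)
  rw [← hSTL, ← ENNReal.ofReal_toReal hfin, ← ENNReal.ofReal_mul (by positivity),
    ← enorm_eq_nnnorm, ← ofReal_norm, ← ENNReal.ofReal_pow (norm_nonneg _),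
    ENNReal.ofReal_le_ofReal_iff (by positivity), inner_self_eq_norm_sq_to_K] at hcs
  rw [← ENNReal.ofReal_toReal hfin]
  refine ENNReal.ofReal_le_ofReal ?_
  rw [inv_mul_le_iff₀ hM]
  refine le_of_mul_le_mul_left ?_ (pow_pos hg' 2)
  calc ‖STL f‖ ^ 2 * ‖STL f‖ ^ 2 = ‖((‖STL f‖ : ℂ)) ^ 2‖ ^ 2 := by
        simp [pow_two]
    _ ≤ _ := hcs
    _ = _ := by ring
end
end
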